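/- Let U ⊂ ℝ⁴ be an open neighborhood of C₊ that is invariant under multiplication by positive scalars, and let f: U → ℂ be smooth with f(λl) = λ^{-2} f(l) for all λ > 0 and l ∈ U. Then for all indices a,b ∈ {0,1,2,3}: ∫_{S²} (L_{ab} f)(1, n̂) dΩ(n̂) = 0. -/

import Mathlib

/-!
Statement 14: for `f` smooth on a scale-invariant neighborhood of the forward light cone
and homogeneous of degree `−2`, the integral of `L_{ab} f` over the null directions vanishes:
`∫_{S²} (L_{ab} f)(1,n̂) dΩ(n̂) = 0`.
-/

open Real MeasureTheory

noncomputable section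

/-- Minkowski inner product on ℝ⁴ with signature `(+,−,−,−)`. -/
def mink4 (x y : Fin 4 → ℝ) : ℝ := x 0 * y 0 - x 1 * y 1 - x 2 * y 2 - x 3 * y 3

/-- Index lowering: `x_a = η_{ab} x^b`. -/
def low (x : Fin 4 → ℝ) (a : Fin 4) : ℝ := if a = 0 then x 0 else -(x a)

/-- The null vector `(1, n̂)` associated with a unit vector `n̂ ∈ ℝ³`. -/
def toCone (n : EuclideanSpace ℝ (Fin 3)) : Fin 4 → ℝ := ![1, n 0, n 1, n 2]

section Divergence

open Set Module

theorem fderiv_smul_of_homogeneous {E : Type*} [NormedAddCommGroup E] [NormedSpace ℝ E]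
    {H : E → ℂ} {m : ℕ}
    (hH : ∀ r : ℝ, 0 < r → ∀ x : E, x ≠ 0 → H (r • x) = (r ^ m)⁻¹ • H x)
    {r : ℝ} (hr : 0 < r) {x : E} (hx : x ≠ 0) :
    fderiv ℝ H (r • x) = (r ^ (m + 1))⁻¹ • fderiv ℝ H x := by
  have h1 : (fun y => H (r • y)) =ᶠ[nhds x] fun y => (r ^ m)⁻¹ • H y := by
    filter_upwards [isOpen_ne.mem_nhds hx] with y hy using hH r hr y hy
  have h2 := h1.fderiv_eq (𝕜 := ℝ)
  rw [fderiv_comp_smul] at h2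
  change _ = fderiv ℝ ((r ^ m)⁻¹ • H) x at h2
  rw [fderiv_const_smul_field, Pi.smul_apply] at h2
  rw [pow_succ', mul_inv, mul_smul, ← h2, smul_smul, inv_mul_cancel₀ hr.ne', one_smul]

variable {E : Type*} [NormedAddCommGroup E] [InnerProductSpace ℝ E] [FiniteDimensional ℝ E]
  [MeasurableSpace E] [BorelSpace E] [Nontrivial E] (μ : Measure E) [μ.IsAddHaarMeasure]

/-- Polar coordinates for a function that splits into an angular and a radial factor. -/
theorem integral_eq_toSphere_mul_integral_Ioi {g k : E → ℂ} {ψ : ℝ → ℂ}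
    (hg : ∀ r : ℝ, 0 < r → ∀ n : E, ‖n‖ = 1 → g (r • n) = k n * ψ r) :
    ∫ x, g x ∂μ = (∫ n : Metric.sphere (0 : E) 1, k n ∂μ.toSphere) *
      ∫ r in Ioi (0 : ℝ), r ^ (finrank ℝ E - 1) • ψ r :=
  calc
    ∫ x, g x ∂μ = ∫ x : ({(0)}ᶜ : Set E), g x.1 ∂(μ.comap (↑)) := by
      rw [integral_subtype_comap (measurableSet_singleton _).compl g, restrict_compl_singleton]
    _ = ∫ z, k z.1 * ψ z.2 ∂μ.toSphere.prod (.volumeIoiPow (finrank ℝ E - 1)) := by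
      rw [← μ.measurePreserving_homeomorphUnitSphereProd.integral_comp
        (Homeomorph.measurableEmbedding _)]
      refine integral_congr_ae (.of_forall fun x => ?_)
      have hx : ‖x.1‖ ≠ 0 := norm_ne_zero_iff.2 x.2
      have h := hg ‖x.1‖ (norm_pos_iff.2 x.2) (‖x.1‖⁻¹ • x.1) (by simp [norm_smul, hx])
      rw [smul_smul, mul_inv_cancel₀ hx, one_smul] at h
      simpa using h
    _ = (∫ n : Metric.sphere (0 : E) 1, k n ∂μ.toSphere) *
        ∫ r : Ioi (0 : ℝ), ψ r ∂.volumeIoiPow (finrank ℝ E - 1) :=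
      integral_prod_mul (fun n : Metric.sphere (0 : E) 1 => k n) (fun r : Ioi (0 : ℝ) => ψ r)
    _ = _ := by
      congr 1
      simp only [Measure.volumeIoiPow, ENNReal.ofReal]
      rw [integral_withDensity_eq_integral_smul,
        integral_subtype_comap measurableSet_Ioi
          fun a ↦ Real.toNNReal (a ^ (finrank ℝ E - 1)) • ψ a,
        setIntegral_congr_fun measurableSet_Ioi fun x hx ↦ ?_]
      · rw [NNReal.smul_def, Real.coe_toNNReal _ (pow_nonneg hx.out.le _)]
      · exact (measurable_subtype_coe.pow_const _).real_toNNReal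

/-- On the unit sphere of a `(m + 1)`-dimensional space, every directional derivative of a
function homogeneous of degree `-m` has integral zero. -/
theorem integral_toSphere_fderiv_eq_zero {H : E → ℂ} {m : ℕ} (hm : finrank ℝ E = m + 1)
    (hHd : ContDiffOn ℝ 1 H {0}ᶜ)
    (hH : ∀ r : ℝ, 0 < r → ∀ x : E, x ≠ 0 → H (r • x) = (r ^ m)⁻¹ • H x) (v : E) :
    ∫ n : Metric.sphere (0 : E) 1, fderiv ℝ H n v ∂μ.toSphere = 0 := by
  let b : ContDiffBump (2 : ℝ) := ⟨1 / 2, 1, by norm_num, by norm_num⟩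
  have hb0 : ∀ t : ℝ, t < 1 → b t = 0 := fun t ht =>
    b.zero_of_le_dist (by
      rw [Real.dist_eq, abs_of_neg (by linarith)]; change (1 : ℝ) ≤ _; linarith)
  have hb3 : ∀ t : ℝ, 3 < t → b t = 0 := fun t ht =>
    b.zero_of_le_dist (by
      rw [Real.dist_eq, abs_of_pos (by linarith)]; change (1 : ℝ) ≤ _; linarith)
  let φ : E → ℝ := fun x => b (‖x‖ ^ 2)
  have hbC : ContDiff ℝ 1 b := b.contDiff
  have hφC : ContDiff ℝ 1 φ := hbC.comp (contDiff_norm_sq ℝ)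
  have hφ0 : tsupport φ ⊆ {0}ᶜ := by
    have hc : IsClosed {x : E | 1 ≤ ‖x‖ ^ 2} := isClosed_le (by fun_prop) (by fun_prop)
    have hs : tsupport φ ⊆ {x : E | 1 ≤ ‖x‖ ^ 2} := by
      refine closure_minimal (fun x hx => ?_) hc
      by_contra h
      exact hx (hb0 _ (not_le.1 h))
    rintro x hx rfl
    have := hs hx
    norm_num at this
  have hφc : HasCompactSupport φ := by
    refine HasCompactSupport.intro (isCompact_closedBall (0 : E) 2) fun x hx => hb3 _ ?_
    have : 2 < ‖x‖ := by simpa using hx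
    nlinarith
  have hopen : IsOpen ({0}ᶜ : Set E) := isOpen_compl_singleton
  have hH'C : ContinuousOn (fun x => fderiv ℝ H x v) {0}ᶜ :=
    (hHd.continuousOn_fderiv_of_isOpen hopen le_rfl).clm_apply continuousOn_const
  have hφ'C : Continuous fun x => fderiv ℝ φ x v :=
    (hφC.continuous_fderiv one_ne_zero).clm_apply continuous_const
  have hφ'c : HasCompactSupport fun x => fderiv ℝ φ x v := hφc.fderiv_apply ℝ v
  have hφ's : tsupport (fun x => fderiv ℝ φ x v) ⊆ {0}ᶜ :=
    (tsupport_fderiv_apply_subset ℝ v).trans hφ0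
  have key : ∀ (p : E → ℝ) (q : E → ℂ), Continuous p → HasCompactSupport p →
      tsupport p ⊆ {0}ᶜ → ContinuousOn q {0}ᶜ → Integrable (fun x => p x • q x) μ := by
    intro p q hp hpc hps hq
    have hc : HasCompactSupport (fun x => p x • q x) := hpc.smul_right
    refine Continuous.integrable_of_hasCompactSupport ?_ hc
    exact (hp.continuousOn.smul hq).continuous_of_tsupport_subset hopen
      ((tsupport_smul_subset_left p q).trans hps)
  have parts := integral_smul_fderiv_eq_neg_fderiv_smul_of_integrable (μ := μ) (f := φ) (g := H)
    (v := v) (key _ _ hφ'C hφ'c hφ's hHd.continuousOn) (key _ _ hφC.continuous hφc hφ0 hH'C)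
    (key _ _ hφC.continuous hφc hφ0 hHd.continuousOn)
    (fun x _ => hφC.differentiable one_ne_zero x)
    (fun x hx => (hHd.differentiableOn one_ne_zero).differentiableAt
      (hopen.mem_nhds (hφ0 hx)))
  let s : ℝ → ℝ := fun r => b (r ^ 2)
  have hsC : ContDiff ℝ 1 s := hbC.comp (contDiff_id.pow 2)
  have hsc : HasCompactSupport s := by
    refine HasCompactSupport.intro (isCompact_closedBall (0 : ℝ) 2) fun x hx => hb3 _ ?_
    have : 2 < |x| := by simpa using hx
    nlinarith [sq_abs x]
  have hne : ∀ n : E, ‖n‖ = 1 → n ≠ 0 := fun n hn h => by simp [h] at hn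
  have hd : ∀ r : ℝ, 0 < r → ∀ n : E, ‖n‖ = 1 →
      fderiv ℝ φ (r • n) v = deriv s r * inner ℝ n v := by
    intro r hr n hn
    have hbd := (hbC.differentiable one_ne_zero (r ^ 2)).hasDerivAt
    have h1 : HasFDerivAt φ _ (r • n) := HasDerivAt.comp_hasFDerivAt_of_eq (h₂ := b) (r • n) hbd
      (hasStrictFDerivAt_norm_sq (r • n)).hasFDerivAt (by simp [norm_smul, hn])
    have h2 : HasDerivAt s _ r := HasDerivAt.comp (h₂ := b) r hbd (hasDerivAt_pow 2 r)
    rw [h1.fderiv, h2.deriv]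
    simp
    ring
  have lhs := integral_eq_toSphere_mul_integral_Ioi μ
    (g := fun x => φ x • fderiv ℝ H x v) (k := fun n => fderiv ℝ H n v)
    (ψ := fun r => ((s r * (r ^ (m + 1))⁻¹ : ℝ) : ℂ)) (by
      intro r hr n hn
      rw [fderiv_smul_of_homogeneous hH hr (hne n hn)]
      simp [φ, s, norm_smul, hn]
      ring)
  have rhs := integral_eq_toSphere_mul_integral_Ioi μ
    (g := fun x => fderiv ℝ φ x v • H x) (k := fun n => (inner ℝ n v : ℝ) * H n)
    (ψ := fun r => ((deriv s r * (r ^ m)⁻¹ : ℝ) : ℂ)) (by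
      intro r hr n hn
      rw [hH r hr n (hne n hn), hd r hr n hn]
      simp
      ring)
  have hr0 : ∫ r in Ioi (0 : ℝ), r ^ (finrank ℝ E - 1) • ((deriv s r * (r ^ m)⁻¹ : ℝ) : ℂ) = 0 := by
    rw [setIntegral_congr_fun (g := fun r => ((deriv s r : ℝ) : ℂ)) measurableSet_Ioi,
      integral_complex_ofReal, hsc.integral_Ioi_deriv_eq hsC]
    · simp [s, hb0]
    · intro r hr
      have : (r : ℂ) ≠ 0 := by exact_mod_cast (ne_of_gt hr.out)
      simp [hm]
      field_simp
  have hl0 : ∫ r in Ioi (0 : ℝ),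
      r ^ (finrank ℝ E - 1) • ((s r * (r ^ (m + 1))⁻¹ : ℝ) : ℂ) ≠ 0 := by
    rw [setIntegral_congr_fun (g := fun r => ((s r * r⁻¹ : ℝ) : ℂ)) measurableSet_Ioi,
      integral_complex_ofReal, Complex.ofReal_ne_zero]
    · have hss : tsupport s ⊆ {0}ᶜ := by
        have hc : IsClosed {x : ℝ | 1 ≤ x ^ 2} := isClosed_le (by fun_prop) (by fun_prop)
        have hs : tsupport s ⊆ {x : ℝ | 1 ≤ x ^ 2} := by
          refine closure_minimal (fun x hx => ?_) hc
          by_contra h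
          exact hx (hb0 _ (not_le.1 h))
        rintro x hx rfl
        have := hs hx
        norm_num at this
      have hcont : Continuous fun r => s r * r⁻¹ :=
        (hsC.continuous.continuousOn.mul continuousOn_inv₀).continuous_of_tsupport_subset
          isOpen_compl_singleton ((tsupport_mul_subset_left).trans hss)
      have hint : Integrable (fun r => s r * r⁻¹) :=
        hcont.integrable_of_hasCompactSupport hsc.mul_right
      refine ne_of_gt ((setIntegral_pos_iff_support_of_nonneg_ae ?_ hint.integrableOn).2 ?_)
      · filter_upwards [ae_restrict_mem measurableSet_Ioi] with r hr
        exact mul_nonneg b.nonneg (inv_nonneg.2 (le_of_lt hr))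
      · refine (hcont.isOpen_support.inter isOpen_Ioi).measure_pos _ ⟨√2, ?_, ?_⟩
        · have : b (2 : ℝ) = 1 := b.one_of_mem_closedBall (by simp; norm_num [b])
          simp [s, this]
        · simp
    · intro r hr
      have : (r : ℂ) ≠ 0 := by exact_mod_cast (ne_of_gt hr.out)
      simp [hm]
      field_simp
      ring
  rw [lhs, rhs, hr0, mul_zero, neg_zero] at parts
  exact (mul_eq_zero.1 parts).resolve_right hl0

end Divergence

section Cone

/-- The spatial inclusion `x ↦ (0, x)` of `ℝ³` into `ℝ⁴`. -/
def spatialIncl : EuclideanSpace ℝ (Fin 3) →L[ℝ] (Fin 4 → ℝ) :=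
  ContinuousLinearMap.pi (Fin.cons 0 fun i => EuclideanSpace.proj i)

/-- The parametrization `x ↦ (‖x‖, x)` of the forward light cone. -/
def coneParam (x : EuclideanSpace ℝ (Fin 3)) : Fin 4 → ℝ :=
  ‖x‖ • Pi.single 0 1 + spatialIncl x

theorem coneParam_zero (x : EuclideanSpace ℝ (Fin 3)) : coneParam x 0 = ‖x‖ := by
  simp [coneParam, spatialIncl]

theorem coneParam_succ (x : EuclideanSpace ℝ (Fin 3)) (i : Fin 3) :
    coneParam x i.succ = x i := by
  simp [coneParam, spatialIncl]

theorem coneParam_eq_toCone {n : EuclideanSpace ℝ (Fin 3)} (hn : ‖n‖ = 1) :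
    coneParam n = toCone n := by
  ext i
  refine Fin.cases ?_ (fun j => ?_) i
  · simp [coneParam_zero, toCone, hn]
  · rw [coneParam_succ]
    fin_cases j <;> rfl

theorem coneParam_mem_cone {x : EuclideanSpace ℝ (Fin 3)} (hx : x ≠ 0) :
    mink4 (coneParam x) (coneParam x) = 0 ∧ 0 < coneParam x 0 := by
  refine ⟨?_, by simpa [coneParam_zero] using hx⟩
  have h := EuclideanSpace.real_norm_sq_eq x
  rw [Fin.sum_univ_three] at h
  have h1 : coneParam x 1 = x 0 := coneParam_succ x 0
  have h2 : coneParam x 2 = x 1 := coneParam_succ x 1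
  have h3 : coneParam x 3 = x 2 := coneParam_succ x 2
  rw [mink4, coneParam_zero, h1, h2, h3]
  linarith

theorem coneParam_smul {r : ℝ} (hr : 0 < r) (x : EuclideanSpace ℝ (Fin 3)) :
    coneParam (r • x) = r • coneParam x := by
  simp [coneParam, norm_smul, abs_of_pos hr, smul_smul]

theorem contDiffOn_coneParam : ContDiffOn ℝ 1 coneParam {0}ᶜ := fun _ hx =>
  (((contDiffAt_norm ℝ hx).smul contDiffAt_const).add
    spatialIncl.contDiff.contDiffAt).contDiffWithinAt

theorem hasFDerivAt_norm_of_norm_eq_one {E : Type*} [NormedAddCommGroup E]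
    [InnerProductSpace ℝ E] {n : E} (hn : ‖n‖ = 1) :
    HasFDerivAt (fun x : E => ‖x‖) (innerSL ℝ n) n := by
  have h := (hasStrictFDerivAt_norm_sq n).hasFDerivAt.sqrt (by simp [hn])
  simp only [Real.sqrt_sq (norm_nonneg _)] at h
  convert h using 1
  ext v
  simp [hn]

theorem low_toCone_zero (n : EuclideanSpace ℝ (Fin 3)) : low (toCone n) 0 = 1 := by
  simp [low, toCone]

theorem low_toCone_succ {n : EuclideanSpace ℝ (Fin 3)} (hn : ‖n‖ = 1) (i : Fin 3) :
    low (toCone n) i.succ = -n i := by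
  rw [← coneParam_eq_toCone hn, low, if_neg (Fin.succ_ne_zero i), coneParam_succ]

variable {f : (Fin 4 → ℝ) → ℂ}

theorem hasFDerivAt_comp_coneParam {n : EuclideanSpace ℝ (Fin 3)} (hn : ‖n‖ = 1)
    (hf : DifferentiableAt ℝ f (toCone n)) :
    HasFDerivAt (fun x => f (coneParam x))
      ((fderiv ℝ f (toCone n)).comp
        ((innerSL ℝ n).smulRight (Pi.single 0 1) + spatialIncl)) n := by
  rw [← coneParam_eq_toCone hn] at hf ⊢
  exact hf.hasFDerivAt.comp n
    (((hasFDerivAt_norm_of_norm_eq_one hn).smul_const _).add spatialIncl.hasFDerivAt)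

theorem spatialIncl_single (i : Fin 3) :
    spatialIncl (EuclideanSpace.single i 1) = Pi.single i.succ 1 := by
  ext a
  refine Fin.cases ?_ (fun j => ?_) a
  · simp [spatialIncl]
  · simp [spatialIncl, Pi.single_apply]

/-- Boosts: on the sphere, `L_{0i} f` is the `i`-th partial derivative of `x ↦ f (‖x‖, x)`. -/
theorem fderiv_comp_coneParam {n : EuclideanSpace ℝ (Fin 3)} (hn : ‖n‖ = 1)
    (hf : DifferentiableAt ℝ f (toCone n)) (i : Fin 3) :
    fderiv ℝ (fun x => f (coneParam x)) n (EuclideanSpace.single i 1) =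
      (n i : ℂ) * fderiv ℝ f (toCone n) (Pi.single 0 1) +
        fderiv ℝ f (toCone n) (Pi.single i.succ 1) := by
  rw [(hasFDerivAt_comp_coneParam hn hf).fderiv]
  simp [spatialIncl_single, EuclideanSpace.inner_single_right]

theorem fderiv_weighted_comp_coneParam {n : EuclideanSpace ℝ (Fin 3)} (hn : ‖n‖ = 1)
    (hf : DifferentiableAt ℝ f (toCone n)) (i j : Fin 3) :
    fderiv ℝ (fun x => (‖x‖⁻¹ * x i) • f (coneParam x)) n (EuclideanSpace.single j 1) =
      (n i : ℂ) * ((n j : ℂ) * fderiv ℝ f (toCone n) (Pi.single 0 1) +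
        fderiv ℝ f (toCone n) (Pi.single j.succ 1)) +
      (((if i = j then 1 else 0) - n i * n j : ℝ) : ℂ) * f (toCone n) := by
  have hinv : HasFDerivAt (fun x : EuclideanSpace ℝ (Fin 3) => ‖x‖⁻¹) _ n :=
    (hasDerivAt_inv (by simp [hn])).comp_hasFDerivAt n (hasFDerivAt_norm_of_norm_eq_one hn)
  have hw := hinv.mul (EuclideanSpace.proj (𝕜 := ℝ) i).hasFDerivAt
  have h := hw.smul (hasFDerivAt_comp_coneParam hn hf)
  have h' := congrArg (fun L => L (EuclideanSpace.single j (1 : ℝ))) h.fderiv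
  refine h'.trans ?_
  simp [spatialIncl_single, EuclideanSpace.inner_single_right, hn, coneParam_eq_toCone hn]
  ring

end Cone

theorem integral_L_homogeneous_zero (U : Set (Fin 4 → ℝ)) (hUopen : IsOpen U)
    (hUcone : {l : Fin 4 → ℝ | mink4 l l = 0 ∧ 0 < l 0} ⊆ U)
    (hUscale : ∀ lam : ℝ, 0 < lam → ∀ l ∈ U, lam • l ∈ U)
    (f : (Fin 4 → ℝ) → ℂ) (hf : ContDiffOn ℝ (⊤ : ℕ∞) f U)
    (hhom : ∀ lam : ℝ, 0 < lam → ∀ l ∈ U, f (lam • l) = ((lam : ℂ) ^ (-2 : ℤ)) * f l)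
    (a b : Fin 4) :
    (∫ n : Metric.sphere (0 : EuclideanSpace ℝ (Fin 3)) 1,
        (((low (toCone n) a : ℝ) : ℂ) * fderiv ℝ f (toCone n) (Pi.single b 1) -
         ((low (toCone n) b : ℝ) : ℂ) * fderiv ℝ f (toCone n) (Pi.single a 1))
      ∂(volume : Measure (EuclideanSpace ℝ (Fin 3))).toSphere) = 0 := by
  have hmem : ∀ x : EuclideanSpace ℝ (Fin 3), x ≠ 0 → coneParam x ∈ U :=
    fun x hx => hUcone (coneParam_mem_cone hx)
  have hnorm : ∀ n : Metric.sphere (0 : EuclideanSpace ℝ (Fin 3)) 1, ‖n.1‖ = 1 :=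
    fun n => by simp
  have hdiff : ∀ n : Metric.sphere (0 : EuclideanSpace ℝ (Fin 3)) 1,
      DifferentiableAt ℝ f (toCone n) := fun n =>
    (hf.differentiableOn (by simp)).differentiableAt
      (hUopen.mem_nhds (coneParam_eq_toCone (hnorm n) ▸ hmem n.1 (by
        rw [← norm_ne_zero_iff, hnorm n]; exact one_ne_zero)))
  have hFd : ContDiffOn ℝ 1 (fun x => f (coneParam x)) {0}ᶜ :=
    (hf.of_le (by exact_mod_cast le_top)).comp contDiffOn_coneParam hmem
  have hFh : ∀ r : ℝ, 0 < r → ∀ x : EuclideanSpace ℝ (Fin 3), x ≠ 0 →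
      f (coneParam (r • x)) = (r ^ 2)⁻¹ • f (coneParam x) := by
    intro r hr x hx
    rw [coneParam_smul hr, hhom r hr _ (hmem x hx), zpow_neg]
    simp
  have hboost : ∀ i : Fin 3, ∫ n : Metric.sphere (0 : EuclideanSpace ℝ (Fin 3)) 1,
      (((low (toCone n) 0 : ℝ) : ℂ) * fderiv ℝ f (toCone n) (Pi.single i.succ 1) -
         ((low (toCone n) i.succ : ℝ) : ℂ) * fderiv ℝ f (toCone n) (Pi.single 0 1))
      ∂(volume : Measure (EuclideanSpace ℝ (Fin 3))).toSphere = 0 := by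
    intro i
    rw [← integral_toSphere_fderiv_eq_zero volume (by simp) hFd hFh (EuclideanSpace.single i 1)]
    refine integral_congr_ae (.of_forall fun n => ?_)
    simp only [fderiv_comp_coneParam (hnorm n) (hdiff n), low_toCone_zero,
      low_toCone_succ (hnorm n)]
    push_cast
    ring
  refine Fin.cases ?_ (fun i => ?_) a <;> refine Fin.cases ?_ (fun j => ?_) b
  · simp
  · exact hboost j
  · rw [← neg_eq_zero, ← integral_neg, ← hboost i]
    simp only [neg_sub]
  · let G : Fin 3 → EuclideanSpace ℝ (Fin 3) → ℂ :=
      fun k x => (‖x‖⁻¹ * x k) • f (coneParam x)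
    have hGd : ∀ k, ContDiffOn ℝ 1 (G k) {0}ᶜ := fun k =>
      ContDiffOn.smul (fun x (hx : x ≠ 0) => (((contDiffAt_norm ℝ hx).inv (norm_ne_zero_iff.2 hx)).mul
        (EuclideanSpace.proj (𝕜 := ℝ) k).contDiff.contDiffAt).contDiffWithinAt) hFd
    have hGh : ∀ k, ∀ r : ℝ, 0 < r → ∀ x : EuclideanSpace ℝ (Fin 3), x ≠ 0 →
        G k (r • x) = (r ^ 2)⁻¹ • G k x := by
      intro k r hr x hx
      simp only [G]
      rw [hFh r hr x hx, smul_comm, norm_smul, Real.norm_of_nonneg hr.le, PiLp.smul_apply,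
        smul_eq_mul]
      congr 2
      field_simp
    have hGi : ∀ k l, Integrable (fun n : Metric.sphere (0 : EuclideanSpace ℝ (Fin 3)) 1 =>
        fderiv ℝ (G k) n (EuclideanSpace.single l 1))
        (volume : Measure (EuclideanSpace ℝ (Fin 3))).toSphere := by
      intro k l
      refine Continuous.integrable_of_hasCompactSupport ?_ (.of_compactSpace _)
      have h := ((hGd k).continuousOn_fderiv_of_isOpen isOpen_compl_singleton le_rfl).clm_apply
        (continuousOn_const (c := EuclideanSpace.single l (1 : ℝ)))
      refine h.comp_continuous continuous_subtype_val fun n => ?_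
      rw [Set.mem_compl_singleton_iff, ← norm_ne_zero_iff, hnorm n]
      exact one_ne_zero
    have hzero : ∀ k l, ∫ n : Metric.sphere (0 : EuclideanSpace ℝ (Fin 3)) 1,
        fderiv ℝ (G k) n (EuclideanSpace.single l 1)
        ∂(volume : Measure (EuclideanSpace ℝ (Fin 3))).toSphere = 0 := fun k l =>
      integral_toSphere_fderiv_eq_zero volume (by simp) (hGd k) (hGh k) _
    have hsub := integral_sub (hGi j i) (hGi i j)
    rw [hzero, hzero, sub_zero] at hsub
    rw [← hsub]
    refine integral_congr_ae (.of_forall fun n => ?_)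
    simp only [G, fderiv_weighted_comp_coneParam (hnorm n) (hdiff n),
      low_toCone_succ (hnorm n), eq_comm (a := j)]
    push_cast
    ring

end
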